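/- arXiv:2511.18401 — 3 statements merged into one kernel-verified Lean document; each statement's English description precedes it below -/
import Mathlib

section
/- Let N ≥ 1 and k ≥ 1, and let A : [0,1] → M_N(ℂ) be a continuous family of complex N×N matrices such that A(s)^k = I for every s ∈ [0,1]. Then for every ζ ∈ ℂ the function s ↦ dim_ℂ ker(A(s) − ζ·I) is constant on [0,1]; consequently A(0) and A(1) are similar, i.e. conjugate in GL(N,ℂ). -/
noncomputable section

open Matrix

lemma aux_conj {N k : ℕ} (A B : Matrix (Fin N) (Fin N) ℂ) (hA : A ^ k = 1) (hB : B ^ k = 1) :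
    A * (∑ j ∈ Finset.range k, A ^ j * B ^ (k - j)) =
      (∑ j ∈ Finset.range k, A ^ j * B ^ (k - j)) * B := by
  rw [← sub_eq_zero, Finset.mul_sum, Finset.sum_mul, ← Finset.sum_sub_distrib]
  have h : ∀ j ∈ Finset.range k, A * (A ^ j * B ^ (k - j)) - A ^ j * B ^ (k - j) * B =
      A ^ (j + 1) * B ^ (k + 1 - (j + 1)) - A ^ j * B ^ (k + 1 - j) := by
    intro j hj
    have hj' := Finset.mem_range.1 hj
    have e1 : k + 1 - (j + 1) = k - j := by omega
    have e2 : k + 1 - j = (k - j) + 1 := by omega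
    rw [e1, e2, pow_succ' A j, pow_succ B (k - j), mul_assoc, mul_assoc]
  rw [Finset.sum_congr rfl h, Finset.sum_range_sub (fun j => A ^ j * B ^ (k + 1 - j))]
  simp [hA, pow_succ, hB]

/-- For a continuous family `A : [0,1] → M_N(ℂ)` of matrices with
`A(s)ᵏ = I`, the eigenvalue multiplicities `dim ker (A(s) − ζI)` are constant in `s`;
consequently `A(0)` and `A(1)` are conjugate in `GL(N,ℂ)`. -/
theorem finite_order_continuous_family_rigidity
    (N k : ℕ) (hN : 1 ≤ N) (hk : 1 ≤ k)
    (A : ℝ → Matrix (Fin N) (Fin N) ℂ)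
    (hcont : ContinuousOn A (Set.Icc (0 : ℝ) 1))
    (hfin : ∀ s ∈ Set.Icc (0 : ℝ) 1, A s ^ k = 1) :
    (∀ ζ : ℂ, ∀ s ∈ Set.Icc (0 : ℝ) 1,
        Module.finrank ℂ (LinearMap.ker (Matrix.toLin' (A s - ζ • 1))) =
          Module.finrank ℂ (LinearMap.ker (Matrix.toLin' (A 0 - ζ • 1)))) ∧
    ∃ P : Matrix (Fin N) (Fin N) ℂ, IsUnit P ∧ A 1 = P * A 0 * P⁻¹ := by
  have key : ∀ s ∈ Set.Icc (0 : ℝ) 1, ∃ P : (Matrix (Fin N) (Fin N) ℂ)ˣ, A s * P = P * A 0 := by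
    intro s hs
    refine (isPreconnected_Icc (a := (0:ℝ)) (b := 1)).induction₂
      (fun t s => ∃ P : (Matrix (Fin N) (Fin N) ℂ)ˣ, A s * P = P * A t) ?_ ?_ ?_
      (by simp) hs
    · intro t ht
      have hc : ContinuousWithinAt
          (fun s => (∑ j ∈ Finset.range k, A s ^ j * A t ^ (k - j)).det) (Set.Icc 0 1) t := by
        have : Continuous (fun M : Matrix (Fin N) (Fin N) ℂ =>
          (∑ j ∈ Finset.range k, M ^ j * A t ^ (k - j)).det) := by fun_prop
        exact this.continuousAt.comp_continuousWithinAt (hcont t ht)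
      have h0 : (∑ j ∈ Finset.range k, A t ^ j * A t ^ (k - j)).det ≠ 0 := by
        have : (∑ j ∈ Finset.range k, A t ^ j * A t ^ (k - j)) = (k : ℂ) • 1 := by
          rw [Finset.sum_congr rfl (g := fun _ => 1)]
          · simp [Nat.cast_smul_eq_nsmul]
          · intro j hj
            rw [← pow_add, Nat.add_sub_cancel' (Finset.mem_range.1 hj).le, hfin t ht]
        rw [this, Matrix.det_smul, Matrix.det_one, mul_one]
        exact pow_ne_zero _ (by exact_mod_cast (by omega : k ≠ 0))
      filter_upwards [hc.eventually_ne h0, self_mem_nhdsWithin] with s h1 h2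
      have hu := (Matrix.isUnit_iff_isUnit_det _).2 (isUnit_iff_ne_zero.2 h1)
      exact ⟨hu.unit, aux_conj (A s) (A t) (hfin s h2) (hfin t ht)⟩
    · rintro x y z _ _ _ ⟨P, hP⟩ ⟨Q, hQ⟩
      refine ⟨Q * P, ?_⟩
      rw [Units.val_mul, ← mul_assoc, hQ, mul_assoc, hP, mul_assoc]
    · rintro x y _ _ ⟨P, hP⟩
      refine ⟨P⁻¹, ?_⟩
      rw [Units.eq_inv_mul_iff_mul_eq, ← mul_assoc, ← hP, mul_assoc, Units.mul_inv, mul_one]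
  constructor
  · intro ζ s hs
    obtain ⟨P, hP⟩ := key s hs
    have h : (A s - ζ • 1) * P = P * (A 0 - ζ • 1) := by
      rw [sub_mul, mul_sub, hP]; simp
    have hr : (A s - ζ • 1).rank = (A 0 - ζ • 1).rank := by
      rw [← Matrix.rank_mul_eq_left_of_isUnit_det (P : Matrix (Fin N) (Fin N) ℂ) (A s - ζ • 1)
        ((Matrix.isUnit_iff_isUnit_det _).1 P.isUnit), h,
        Matrix.rank_mul_eq_right_of_isUnit_det _ _
        ((Matrix.isUnit_iff_isUnit_det _).1 P.isUnit)]
    have e1 := LinearMap.finrank_range_add_finrank_ker (Matrix.toLin' (A s - ζ • 1))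
    have e2 := LinearMap.finrank_range_add_finrank_ker (Matrix.toLin' (A 0 - ζ • 1))
    have e3 : Module.finrank ℂ (LinearMap.range (Matrix.toLin' (A s - ζ • 1))) =
      Module.finrank ℂ (LinearMap.range (Matrix.toLin' (A 0 - ζ • 1))) := hr
    omega
  · obtain ⟨P, hP⟩ := key 1 (by simp)
    refine ⟨P, P.isUnit, ?_⟩
    rw [← hP, mul_assoc, Matrix.mul_nonsing_inv _ ((Matrix.isUnit_iff_isUnit_det _).1 P.isUnit),
      mul_one]
end
end

section
/- Let U ⊆ ℝ^N be open and ψ : U → U a smooth map such that the k-fold composition ψ∘⋯∘ψ equals the identity of U for some integer k ≥ 1. If z₀ and z₁ lie in the same connected component of the fixed-point set {z ∈ U : ψ(z) = z}, then the differentials Dψ(z₀) and Dψ(z₁) are conjugate in GL(N,ℝ): there exists an invertible real N×N matrix P with Dψ(z₁) = P·Dψ(z₀)·P^{-1}. -/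
noncomputable section

theorem aux_ring {R : Type*} [Ring R] [Algebra ℝ R] (A B : R) (k : ℕ) (hA : A ^ k = 1) (hB : B ^ k = 1) :
    B * (∑ i ∈ Finset.range k, B ^ i * A ^ (k - i)) =
      (∑ i ∈ Finset.range k, B ^ i * A ^ (k - i)) * A := by
  have h := Finset.sum_range_sub (fun i => B ^ i * A ^ (k + 1 - i)) k
  simp only [hB, Nat.add_sub_cancel_left, pow_one, one_mul, pow_zero, Nat.sub_zero, pow_succ A k, hA,
    sub_self] at h
  rw [← sub_eq_zero, ← h, Finset.mul_sum, Finset.sum_mul, ← Finset.sum_sub_distrib]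
  refine Finset.sum_congr rfl fun i hi => ?_
  have hi := Finset.mem_range.1 hi
  rw [show k + 1 - (i + 1) = k - i by omega, show k + 1 - i = (k - i) + 1 by omega, pow_succ' B,
    pow_succ A, mul_assoc, mul_assoc]

theorem aux_local {R : Type*} [NormedRing R] [NormedAlgebra ℝ R] [CompleteSpace R] (A : R) (k : ℕ)
    (hk : 1 ≤ k) (hA : A ^ k = 1) : ∀ᶠ B in nhds A, B ^ k = 1 → IsConj A B := by
  have hc : Continuous fun B : R => ∑ i ∈ Finset.range k, B ^ i * A ^ (k - i) := by fun_prop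
  have h0 : IsUnit (∑ i ∈ Finset.range k, A ^ i * A ^ (k - i)) := by
    have : ∑ i ∈ Finset.range k, A ^ i * A ^ (k - i) = algebraMap ℝ R k := by
      rw [Finset.sum_congr rfl (g := fun _ => (1 : R))]
      · simp
      · intro i hi
        have hi := Finset.mem_range.1 hi
        rw [← pow_add, show i + (k - i) = k by omega, hA]
    rw [this]
    exact (IsUnit.mk0 (k : ℝ) (by positivity)).map (algebraMap ℝ R)
  have := hc.continuousAt.eventually (Units.isOpen.mem_nhds h0)
  filter_upwards [this] with B hu hB
  obtain ⟨u, hu⟩ := hu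
  exact ⟨u, by rw [SemiconjBy, hu]; exact (aux_ring A B k hA hB).symm⟩

/-- If `ψ : U → U` is a smooth map of an open set `U ⊆ ℝᴺ` with
`ψ^[k] = id` and `z₀, z₁` lie in the same connected component of the fixed-point set
of `ψ`, then `Dψ(z₀)` and `Dψ(z₁)` are conjugate in `GL(N,ℝ)`. -/
theorem finite_order_map_conjugate_differentials
    (N : ℕ) (hN : 1 ≤ N)
    (U : Set (EuclideanSpace ℝ (Fin N))) (hU : IsOpen U)
    (ψ : EuclideanSpace ℝ (Fin N) → EuclideanSpace ℝ (Fin N))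
    (hψU : Set.MapsTo ψ U U)
    (hψ : ContDiffOn ℝ (⊤ : ℕ∞) ψ U)
    (k : ℕ) (hk : 1 ≤ k)
    (hord : ∀ z ∈ U, ψ^[k] z = z)
    (z₀ z₁ : EuclideanSpace ℝ (Fin N))
    (hz₀ : z₀ ∈ {z ∈ U | ψ z = z})
    (hz₁ : z₁ ∈ connectedComponentIn {z ∈ U | ψ z = z} z₀) :
    ∃ P : EuclideanSpace ℝ (Fin N) ≃L[ℝ] EuclideanSpace ℝ (Fin N),
      fderiv ℝ ψ z₁ =
        (P : EuclideanSpace ℝ (Fin N) →L[ℝ] EuclideanSpace ℝ (Fin N)) ∘L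
          fderiv ℝ ψ z₀ ∘L
          (P.symm : EuclideanSpace ℝ (Fin N) →L[ℝ] EuclideanSpace ℝ (Fin N)) := by
  have hpow : ∀ z ∈ {z ∈ U | ψ z = z}, (fderiv ℝ ψ z) ^ k = 1 := by
    rintro z ⟨hz, hfix⟩
    have hd : HasFDerivAt ψ (fderiv ℝ ψ z) z :=
      ((hψ.contDiffAt (hU.mem_nhds hz)).differentiableAt (by simp)).hasFDerivAt
    have h1 := hd.iterate hfix k
    have h2 : HasFDerivAt ψ^[k] (ContinuousLinearMap.id ℝ _) z :=
      (hasFDerivAt_id z).congr_of_eventuallyEq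
        (Filter.eventually_of_mem (hU.mem_nhds hz) hord)
    exact h1.unique h2
  have hcont : ContinuousOn (fderiv ℝ ψ) U := hψ.continuousOn_fderiv_of_isOpen hU (by simp)
  have hsub := connectedComponentIn_subset {z ∈ U | ψ z = z} z₀
  have key : IsConj (fderiv ℝ ψ z₀) (fderiv ℝ ψ z₁) := by
    refine (isPreconnected_connectedComponentIn (F := {z ∈ U | ψ z = z}) (x := z₀)).induction₂
      (fun x y => IsConj (fderiv ℝ ψ x) (fderiv ℝ ψ y)) ?_ (fun _ _ _ _ _ _ h h' => h.trans h')
      (fun _ _ _ _ h => h.symm) (mem_connectedComponentIn hz₀) hz₁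
    intro x hx
    have hx' := hsub hx
    have h := (hcont.continuousAt (hU.mem_nhds hx'.1)).eventually
      (aux_local _ k hk (hpow x hx'))
    filter_upwards [mem_nhdsWithin_of_mem_nhds h, self_mem_nhdsWithin] with y hy hy'
    exact hy (hpow y (hsub hy'))
  obtain ⟨c, hc⟩ := key
  refine ⟨ContinuousLinearEquiv.ofUnit c, ?_⟩
  have h3 : fderiv ℝ ψ z₁ = c.val * (fderiv ℝ ψ z₀ * c⁻¹.val) := by
    rw [← mul_assoc, hc.eq, mul_assoc, Units.mul_inv, mul_one]
  exact h3
end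
end

section
/- Let Σ ⊆ ℝ be a closed set, p ≥ 2 an integer, and D a function from the positive reals to ℕ satisfying: (i) D(x) ≥ 1 for all x > 0; (ii) D(x) ≤ D(p·x) for all x > 0; (iii) D(a) = D(b) whenever 0 < a ≤ b and the interval [a,b] is disjoint from Σ. Suppose there exists a nondecreasing sequence (C_l) of positive reals with C_l → ∞, sup_l (C_{l+1} − C_l) < ∞, and D(C_l) = 1 for all l. Then D(x) = 1 for every x > 0 with x ∉ Σ. -/
/-- Let `Σ ⊆ ℝ` be closed and let `D : ℝ → ℕ` satisfy: `D ≥ 1` on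
positive reals, the Smith inequality `D(x) ≤ D(p·x)`, and local constancy off `Σ`.
If `D = 1` along a nondecreasing bounded-gap sequence of positive reals tending to
infinity, then `D(x) = 1` for every positive `x ∉ Σ`. -/
theorem smith_propagation
    (Sig : Set ℝ) (hSig : IsClosed Sig)
    (p : ℕ) (hp : 2 ≤ p)
    (D : ℝ → ℕ)
    (hD1 : ∀ x : ℝ, 0 < x → 1 ≤ D x)
    (hSmith : ∀ x : ℝ, 0 < x → D x ≤ D ((p : ℝ) * x))
    (hconst : ∀ a b : ℝ, 0 < a → a ≤ b → Set.Icc a b ∩ Sig = ∅ → D a = D b)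
    (C : ℕ → ℝ) (hmono : Monotone C) (hpos : ∀ l, 0 < C l)
    (htop : Filter.Tendsto C Filter.atTop Filter.atTop)
    (hgap : ∃ G : ℝ, ∀ l : ℕ, C (l + 1) - C l ≤ G)
    (hDC : ∀ l : ℕ, D (C l) = 1) :
    ∀ x : ℝ, 0 < x → x ∉ Sig → D x = 1 := by
  intro x hx hxS
  obtain ⟨G, hG⟩ := hgap
  obtain ⟨e, he, hball⟩ := Metric.isOpen_iff.1 hSig.isOpen_compl x hxS
  have hit : ∀ k : ℕ, ∀ y : ℝ, 0 < y → D y ≤ D ((p : ℝ) ^ k * y) := by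
    intro k
    induction k with
    | zero => intro y hy; simp
    | succ k ih =>
      intro y hy
      have hy2 : 0 < (p : ℝ) ^ k * y := by positivity
      have h := hSmith _ hy2
      have heq : (p : ℝ) ^ (k + 1) * y = p * ((p : ℝ) ^ k * y) := by ring
      rw [heq]
      exact (ih y hy).trans h
  have hp1 : (1 : ℝ) < p := by exact_mod_cast (by omega : 1 < p)
  obtain ⟨k, hk⟩ := pow_unbounded_of_one_lt (max (G / e) (C 0 / x)) hp1
  have hk1 := (div_lt_iff₀ he).1 ((le_max_left _ _).trans_lt hk)
  have hk2 := (div_lt_iff₀ hx).1 ((le_max_right _ _).trans_lt hk)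
  set q : ℝ := (p : ℝ) ^ k with hq
  have hq0 : 0 < q := by positivity
  have hex : ∃ n, q * x < C n := (htop.eventually_gt_atTop (q * x)).exists
  classical
  have hn := Nat.find_spec hex
  have hmin := fun m => @Nat.find_min _ _ hex m
  generalize Nat.find hex = n at hn hmin
  cases n with
  | zero => linarith
  | succ l =>
    have hl := not_lt.1 (hmin l (Nat.lt_succ_self l))
    have hg := hG l
    have hy0 : 0 < C l / q := div_pos (hpos l) hq0
    have hyx : C l / q ≤ x := by rw [div_le_iff₀ hq0]; linarith
    have hye : x - e < C l / q := by rw [lt_div_iff₀ hq0]; nlinarith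
    have hle := hit k _ hy0
    rw [← hq, mul_div_cancel₀ _ hq0.ne', hDC] at hle
    have hc := hconst (C l / q) x hy0 hyx (by
      ext z
      simp only [Set.mem_inter_iff, Set.mem_Icc, Set.mem_empty_iff_false, iff_false]
      rintro ⟨⟨h1, h2⟩, hz⟩
      refine hball ?_ hz
      rw [Metric.mem_ball, Real.dist_eq, abs_lt]
      constructor <;> linarith)
    have := hD1 x hx
    omega
end
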